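/- arXiv:1810.06082 — 3 statements merged into one kernel-verified Lean document; each statement's English description precedes it below -/
import Mathlib

section
/- Let f : X → Y be a morphism of schemes, let j_Y : Y → Ȳ be an open immersion, and suppose the composition j_Y ∘ f factors as f′ ∘ j_X, where j_X : X → X̄ is an open immersion and f′ : X̄ → Ȳ is a proper morphism. Let P = Y ×_Ȳ X̄ be the fiber product of j_Y : Y → Ȳ and f′ : X̄ → Ȳ, with projections pr_Y : P → Y and pr_X̄ : P → X̄, and let h : X → P be the morphism induced by f and j_X (so that pr_Y ∘ h = f and pr_X̄ ∘ h = j_X). Then pr_Y is proper, pr_X̄ is an open immersion, and h is an open immersion; in particular the factorization f = pr_Y ∘ h exhibits f as an open immersion followed by a proper morphism. -/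
open AlgebraicGeometry CategoryTheory CategoryTheory.Limits

/-- Given `f : X ⟶ Y`, an open immersion `j_Y : Y ⟶ Ȳ`, and a factorization of `j_Y ∘ f` as an
open immersion `j_X : X ⟶ X̄` followed by a proper morphism `f' : X̄ ⟶ Ȳ`, the projection
`pr_Y : Y ×_Ȳ X̄ ⟶ Y` is proper, the projection `pr_X̄ : Y ×_Ȳ X̄ ⟶ X̄` is an open immersion,
the induced morphism `h : X ⟶ Y ×_Ȳ X̄` is an open immersion, and `pr_Y ∘ h = f`. -/
theorem compactification_via_pullback
    {X Y Xbar Ybar : AlgebraicGeometry.Scheme} (f : X ⟶ Y) (jY : Y ⟶ Ybar) (jX : X ⟶ Xbar)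
    (f' : Xbar ⟶ Ybar) [AlgebraicGeometry.IsOpenImmersion jY]
    [AlgebraicGeometry.IsOpenImmersion jX] [AlgebraicGeometry.IsProper f']
    (w : f ≫ jY = jX ≫ f') :
    AlgebraicGeometry.IsProper (pullback.fst jY f') ∧
    AlgebraicGeometry.IsOpenImmersion (pullback.snd jY f') ∧
    AlgebraicGeometry.IsOpenImmersion (pullback.lift f jX w) ∧
    pullback.lift f jX w ≫ pullback.fst jY f' = f := by
  have : IsOpenImmersion (pullback.lift f jX w ≫ pullback.snd jY f') := by
    rwa [pullback.lift_snd]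
  exact ⟨inferInstance, inferInstance,
    IsOpenImmersion.of_comp _ (pullback.snd jY f'), pullback.lift_fst _ _ _⟩
end

section
/- Let R be a Noetherian commutative ring, a ⊆ R an ideal, and I an injective R-module. Then the a-power-torsion submodule Γ_a(I) = {x ∈ I : a^n • x = 0 for some n ∈ ℕ} is itself an injective R-module. -/
/-- The `a`-power-torsion submodule `Γ_a(M) = {x ∈ M : a ^ n • x = 0 for some n}`. -/
def idealPowerTorsion {R : Type*} [CommRing R] (a : Ideal R) (M : Type*) [AddCommGroup M]
    [Module R M] : Submodule R M where
  carrier := {x | ∃ n : ℕ, ∀ r ∈ a ^ n, r • x = 0}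
  zero_mem' := ⟨0, fun r _ => smul_zero r⟩
  add_mem' := by
    rintro x y ⟨n, hn⟩ ⟨m, hm⟩
    refine ⟨n + m, fun r hr => ?_⟩
    have h1 : r ∈ a ^ n := Ideal.pow_le_pow_right (Nat.le_add_right n m) hr
    have h2 : r ∈ a ^ m := Ideal.pow_le_pow_right (Nat.le_add_left m n) hr
    rw [smul_add, hn r h1, hm r h2, add_zero]
  smul_mem' := by
    rintro c x ⟨n, hn⟩
    exact ⟨n, fun r hr => by rw [smul_comm, hn r hr, smul_zero]⟩

/-- A finitely generated submodule of `Γ_a(M)` is annihilated by a single power of `a`. -/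
theorem exists_pow_smul_eq_bot_of_fg_of_le_idealPowerTorsion {R : Type*} [CommRing R]
    {a : Ideal R} {M : Type*} [AddCommGroup M] [Module R M] {N : Submodule R M}
    (hN : N.FG) (hle : N ≤ idealPowerTorsion a M) : ∃ n : ℕ, a ^ n • N = ⊥ := by
  induction N, hN using Submodule.fg_induction with
  | singleton x =>
    obtain ⟨n, hn⟩ := hle (Submodule.mem_span_singleton_self x)
    refine ⟨n, ?_⟩
    rw [eq_bot_iff, Submodule.smul_le]
    intro r hr y hy
    obtain ⟨c, rfl⟩ := Submodule.mem_span_singleton.mp hy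
    rw [smul_comm, hn r hr, smul_zero]
    exact zero_mem _
  | sup N₁ N₂ _ _ ih₁ ih₂ =>
    obtain ⟨n₁, h₁⟩ := ih₁ (le_sup_left.trans hle)
    obtain ⟨n₂, h₂⟩ := ih₂ (le_sup_right.trans hle)
    refine ⟨n₁ + n₂, ?_⟩
    rw [Submodule.smul_sup, sup_eq_bot_iff, eq_bot_iff, eq_bot_iff]
    exact ⟨h₁ ▸ Submodule.smul_mono_left (Ideal.pow_le_pow_right (Nat.le_add_right n₁ n₂)),
      h₂ ▸ Submodule.smul_mono_left (Ideal.pow_le_pow_right (Nat.le_add_left n₂ n₁))⟩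

/-- Linear maps into `Γ_a(I)`, with `I` injective, extend along submodules of finite modules. -/
theorem exists_extension_idealPowerTorsion_of_finite {R : Type u} [CommRing R]
    [IsNoetherianRing R] (a : Ideal R) {I : Type v} [AddCommGroup I] [Module R I]
    (hI : Module.Injective R I) {C : Type v} [AddCommGroup C] [Module R C] [Module.Finite R C]
    (K : Submodule R C) (g : K →ₗ[R] idealPowerTorsion a I) :
    ∃ h : C →ₗ[R] idealPowerTorsion a I, ∀ x : K, h x = g x := by
  let g' : K →ₗ[R] I := (idealPowerTorsion a I).subtype ∘ₗ g
  obtain ⟨n, hn⟩ := exists_pow_smul_eq_bot_of_fg_of_le_idealPowerTorsion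
    (a := a) (N := LinearMap.range g') (Module.Finite.iff_fg.mp inferInstance) (by rintro _ ⟨x, rfl⟩; exact (g x).2)
  obtain ⟨k, hk⟩ := a.exists_pow_inf_eq_pow_smul K
  let P : Submodule R C := a ^ (n + k) • ⊤
  have hP : P.comap K.subtype ≤ LinearMap.ker g' := by
    intro x hx
    have hx' : (x : C) ∈ a ^ n • K := by
      have h1 : (x : C) ∈ a ^ (n + k) • ⊤ ⊓ K := ⟨hx, x.2⟩
      rw [hk (n + k) (Nat.le_add_left k n), Nat.add_sub_cancel] at h1
      exact Submodule.smul_mono le_rfl inf_le_right h1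
    have hx'' : x ∈ a ^ n • (⊤ : Submodule R K) := by
      have h1 : (a ^ n • (⊤ : Submodule R K)).map K.subtype = a ^ n • K := by
        rw [Submodule.map_smul'', Submodule.map_subtype_top]
      rw [← h1] at hx'
      obtain ⟨y, hy, hyx⟩ := hx'
      rwa [← Subtype.ext hyx]
    have := Submodule.mem_map_of_mem (f := g') hx''
    rw [Submodule.map_smul'', ← LinearMap.range_eq_map, hn] at this
    exact this
  obtain ⟨h, hh⟩ := hI.out ((P.comap K.subtype).mapQ P K.subtype le_rfl)
    (by rw [← LinearMap.ker_eq_bot, Submodule.ker_mapQ]; simp)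
    ((P.comap K.subtype).liftQ g' hP)
  refine ⟨(h ∘ₗ P.mkQ).codRestrict _ fun c => ⟨n + k, fun r hr => ?_⟩, fun x => ?_⟩
  · rw [← map_smul, LinearMap.comp_apply, Submodule.mkQ_apply,
      (Submodule.Quotient.mk_eq_zero P).mpr (Submodule.smul_mem_smul hr trivial), map_zero]
  · exact Subtype.ext (hh (Submodule.Quotient.mk x))

/-- Over a Noetherian commutative ring, the `a`-power-torsion submodule of an injective module
is injective. -/
theorem injective_idealPowerTorsion_of_injective
    {R : Type u} [CommRing R] [IsNoetherianRing R] (a : Ideal R)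
    {I : Type v} [AddCommGroup I] [Module R I] (hI : Module.Injective R I) :
    Module.Injective R (idealPowerTorsion a I) := by
  refine ⟨fun X Y _ _ _ _ i hi g => ?_⟩
  have : Fact (Function.Injective i) := ⟨hi⟩
  let m := Module.Baer.extensionOfMax i g
  have hm : m.domain = ⊤ := by
    refine Submodule.eq_top_iff'.mpr fun y => ?_
    let C : Submodule R Y := Submodule.span R {y}
    obtain ⟨h, hh⟩ := exists_extension_idealPowerTorsion_of_finite a hI
      (m.domain.comap C.subtype)
      (m.toFun ∘ₗ C.subtype.restrict (p := m.domain.comap C.subtype) fun _ hx => hx)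
    have H : ∀ (x : m.domain) (z : C), (x : Y) = z → m.toLinearPMap x = h z := by
      rintro x z hxz
      have hz : (z : Y) ∈ m.domain := hxz ▸ x.2
      rw [hh ⟨z, hz⟩]
      exact congrArg m.toFun (Subtype.ext hxz)
    let s := m.toLinearPMap.sup ⟨C, h⟩ H
    have hs : m.toLinearPMap ≤ s := LinearPMap.left_le_sup _ _ H
    let m' : Module.Baer.ExtensionOf i g :=
      { s with
        le := m.le.trans hs.1
        is_extension := fun x => (m.is_extension x).trans (hs.2 rfl) }
    have hm' : m' = m := Module.Baer.extensionOfMax_is_max i g m' hs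
    rw [← hm']
    exact (le_sup_right : C ≤ m.domain ⊔ C) (Submodule.mem_span_singleton_self y)
  exact ⟨m.toFun ∘ₗ LinearMap.id.codRestrict m.domain fun _ => hm ▸ trivial,
    fun x => (m.is_extension x).symm⟩
end

section
/- Let R be a Noetherian commutative ring, a ⊆ R an ideal, S a flat commutative R-algebra, and M an R-module. Then the natural S-linear map S ⊗_R Γ_a(M) → S ⊗_R M induced by the inclusion Γ_a(M) ⊆ M is injective, and its image is exactly the (a·S)-power-torsion submodule Γ_{aS}(S ⊗_R M), where a·S denotes the ideal of S generated by the image of a. In particular there is a natural isomorphism of S-modules S ⊗_R Γ_a(M) ≅ Γ_{aS}(S ⊗_R M). -/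
open TensorProduct

/-- If a finite set generates `a ^ n`, it suffices to test `a ^ n`-torsion on the generators. -/
theorem mem_idealPowerTorsion_of_span_eq {R : Type*} [CommRing R] {a : Ideal R} {M : Type*}
    [AddCommGroup M] [Module R M] {n : ℕ} {s : Set R} (hs : Ideal.span s = a ^ n) {x : M}
    (hx : ∀ r ∈ s, r • x = 0) : x ∈ idealPowerTorsion a M := by
  refine ⟨n, fun r hr => ?_⟩
  have h : Ideal.span s ≤ LinearMap.ker (LinearMap.toSpanSingleton R M x) :=
    Ideal.span_le.2 fun r hr => by simpa using hx r hr
  simpa using h (hs.ge hr)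

theorem range_baseChange_le_idealPowerTorsion {R : Type*} [CommRing R] (a : Ideal R)
    (S : Type*) [CommRing S] [Algebra R S] (M : Type*) [AddCommGroup M] [Module R M] :
    LinearMap.range (LinearMap.baseChange S (idealPowerTorsion a M).subtype) ≤
      idealPowerTorsion (a.map (algebraMap R S)) (S ⊗[R] M) := by
  rintro _ ⟨y, rfl⟩
  induction y with
  | zero => simp
  | add y z hy hz => rw [map_add]; exact add_mem hy hz
  | tmul c x =>
    obtain ⟨x, n, hn⟩ := x
    refine mem_idealPowerTorsion_of_span_eq (n := n) (s := algebraMap R S '' (a ^ n : Ideal R))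
      (Ideal.map_pow (algebraMap R S) a n) ?_
    rintro _ ⟨r, hr, rfl⟩
    simp [algebraMap_smul, ← TensorProduct.tmul_smul, hn r hr]

theorem idealPowerTorsion_le_range_baseChange {R : Type*} [CommRing R] [IsNoetherianRing R]
    (a : Ideal R) (S : Type*) [CommRing S] [Algebra R S] [Module.Flat R S]
    (M : Type*) [AddCommGroup M] [Module R M] :
    idealPowerTorsion (a.map (algebraMap R S)) (S ⊗[R] M) ≤
      LinearMap.range (LinearMap.baseChange S (idealPowerTorsion a M).subtype) := by
  classical
  rintro z ⟨n, hn⟩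
  obtain ⟨s, hs⟩ := (isNoetherianRing_iff_ideal_fg R).1 inferInstance (a ^ n)
  let f : M →ₗ[R] (s → M) := LinearMap.pi fun r => LinearMap.lsmul R M r
  have hK : LinearMap.ker f ≤ idealPowerTorsion a M := fun x hx =>
    mem_idealPowerTorsion_of_span_eq hs fun r hr => congrFun hx ⟨r, hr⟩
  have hfz (w : S ⊗[R] M) (r : s) :
      TensorProduct.piRight R R S (fun _ : s => M) (f.lTensor S w) r = (r : R) • w := by
    induction w with
    | zero => simp
    | add w v hw hv => simp only [map_add, Pi.add_apply, hw, hv, smul_add]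
    | tmul c x => simp [f]
  have hz : f.lTensor S z = 0 := by
    apply (TensorProduct.piRight R R S (fun _ : s => M)).injective
    ext r
    rw [hfz, map_zero, Pi.zero_apply, ← algebraMap_smul S (r : R) z]
    refine hn _ ?_
    rw [← Ideal.map_pow]
    exact Ideal.mem_map_of_mem _ (hs.le (Ideal.subset_span r.2))
  obtain ⟨y, rfl⟩ := (Module.Flat.lTensor_exact S (LinearMap.exact_subtype_ker_map f) z).1 hz
  refine ⟨(Submodule.inclusion hK).lTensor S y, ?_⟩
  rw [LinearMap.baseChange_eq_ltensor, ← LinearMap.lTensor_comp_apply]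
  rfl

/-- For a Noetherian commutative ring `R`, an ideal `a`, a flat commutative `R`-algebra `S`
and an `R`-module `M`, the natural `S`-linear map
`S ⊗[R] Γ_a(M) → S ⊗[R] M` is injective with image `Γ_{aS}(S ⊗[R] M)`; in particular
`S ⊗[R] Γ_a(M) ≅ Γ_{aS}(S ⊗[R] M)` as `S`-modules. -/
theorem baseChange_idealPowerTorsion
    {R : Type u} [CommRing R] [IsNoetherianRing R] (a : Ideal R)
    (S : Type v) [CommRing S] [Algebra R S] [Module.Flat R S]
    (M : Type w) [AddCommGroup M] [Module R M] :
    Function.Injective (LinearMap.baseChange S (idealPowerTorsion a M).subtype) ∧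
    LinearMap.range (LinearMap.baseChange S (idealPowerTorsion a M).subtype) =
      idealPowerTorsion (a.map (algebraMap R S)) (S ⊗[R] M) ∧
    Nonempty ((S ⊗[R] idealPowerTorsion a M) ≃ₗ[S]
      idealPowerTorsion (a.map (algebraMap R S)) (S ⊗[R] M)) := by
  have hinj : Function.Injective (LinearMap.baseChange S (idealPowerTorsion a M).subtype) :=
    Module.Flat.lTensor_preserves_injective_linearMap _ (Submodule.subtype_injective _)
  have hrange := le_antisymm (range_baseChange_le_idealPowerTorsion a S M)
    (idealPowerTorsion_le_range_baseChange a S M)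
  exact ⟨hinj, hrange, ⟨(LinearEquiv.ofInjective _ hinj).trans (LinearEquiv.ofEq _ _ hrange)⟩⟩
end
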